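/- For all h, h' ∈ ℝ^{m*} ≅ g₁ and every k ≥ 2, the operators γ(h) and γ(h') commute: γ(h)∘γ(h') = γ(h')∘γ(h) as linear maps from S^k ℝ^m ⊗ Hom(V₁,V₂) to S^{k−2} ℝ^m ⊗ Hom(V₁,V₂). -/

import Mathlib

open scoped BigOperators
noncomputable section
namespace ProjQuant

/-- `ℝ^m`. -/
abbrev Rm (m : ℕ) := Fin m → ℝ

/-- The index set for `(m+1) × (m+1)` matrices, split into blocks. -/
abbrev Idx (m : ℕ) := Sum (Fin m) Unit

/-- `gl(m,ℝ)`, realized as continuous linear endomorphisms of `ℝ^m`. -/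
abbrev GLm (m : ℕ) := (Fin m → ℝ) →L[ℝ] (Fin m → ℝ)

/-- `ℝ^{m*}`. -/
abbrev Dualm (m : ℕ) := (Fin m → ℝ) →L[ℝ] ℝ

/-- The vector field `X^M` on `ℝ^m` attached to a matrix
`M = [[A, v], [ξ, a]] ∈ sl(m+1,ℝ)`, namely `X^M(x) = -v - A x + a x + ξ(x) x`. -/
def projVF (m : ℕ) (M : Matrix (Idx m) (Idx m) ℝ) : Rm m → Rm m := fun x i =>
  -(M (Sum.inl i) (Sum.inr ())) - (∑ j, M (Sum.inl i) (Sum.inl j) * x j)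
    + M (Sum.inr ()) (Sum.inr ()) * x i
    + (∑ j, M (Sum.inr ()) (Sum.inl j) * x j) * x i

/-- The Lie derivative of a `V`-valued function along a vector field `X`, with respect to a
representation `σ` of `gl(m,ℝ)` on `V`:  `(L_X f)(x) = Df(x)[X(x)] - σ(DX(x))(f(x))`. -/
def lieD (m : ℕ) {V : Type} [NormedAddCommGroup V] [NormedSpace ℝ V]
    (σ : GLm m → V → V) (X : Rm m → Rm m) (f : Rm m → V) : Rm m → V :=
  fun x => fderiv ℝ f x (X x) - σ (fderiv ℝ X x) (f x)

/-- `σ` is a Lie algebra representation of `gl(m,ℝ)`. -/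
def IsLieRep (m : ℕ) {V : Type} [NormedAddCommGroup V] [NormedSpace ℝ V]
    (σ : GLm m →ₗ[ℝ] (V →L[ℝ] V)) : Prop :=
  ∀ A B : GLm m, σ (A ∘L B - B ∘L A) = σ A ∘L σ B - σ B ∘L σ A


/-- Iterated Lie derivative along the constant fields `X^{hᵢ} = -hᵢ`, outermost first. -/
def lieItC (m : ℕ) {V : Type} [NormedAddCommGroup V] [NormedSpace ℝ V]
    (σ : GLm m → V → V) : (k : ℕ) → (Fin k → Rm m) → (Rm m → V) → (Rm m → V)
  | 0, _, f => f
  | (k+1), v, f => lieD m σ (fun _ => -(v 0)) (lieItC m σ k (fun j => v j.succ) f)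

section Symbols

variable (m : ℕ) (V₁ V₂ : Type)
  [NormedAddCommGroup V₁] [NormedSpace ℝ V₁] [NormedAddCommGroup V₂] [NormedSpace ℝ V₂]

/-- The model for `S^k ℝ^m ⊗ Hom(V₁,V₂)`: multilinear maps on `k` copies of `ℝ^{m*}`
with values in `Hom(V₁,V₂)` (symbols of degree `k` are the symmetric ones). -/
abbrev Symb (k : ℕ) := ContinuousMultilinearMap ℝ (fun _ : Fin k => Dualm m) (V₁ →L[ℝ] V₂)

/-- The decomposable tensor `h₁ ⊗ ⋯ ⊗ h_k ⊗ A` in the model. -/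
def pureT {k : ℕ} (v : Fin k → Rm m) (A : V₁ →L[ℝ] V₂) : Symb m V₁ V₂ k :=
  (ContinuousMultilinearMap.mkPiRing ℝ (Fin k) A).compContinuousLinearMap
    (fun i => ContinuousLinearMap.apply ℝ ℝ (v i))

/-- The symmetric product `h₁ ∨ ⋯ ∨ h_k ⊗ A` in the model. -/
def symT {k : ℕ} (v : Fin k → Rm m) (A : V₁ →L[ℝ] V₂) : Symb m V₁ V₂ k :=
  ∑ ν : Equiv.Perm (Fin k), pureT m V₁ V₂ (v ∘ ν) A

/-- The subspace of the model corresponding to `S^k ℝ^m ⊗ Hom(V₁,V₂)` itself: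
the span of the symmetric products. -/
def spanGen (k : ℕ) : Submodule ℝ (Symb m V₁ V₂ k) :=
  Submodule.span ℝ {T | ∃ (v : Fin k → Rm m) (A : V₁ →L[ℝ] V₂), T = symT m V₁ V₂ v A}

/-- The rank-one endomorphism `u ⊗ h : x ↦ h(x) • u` of `ℝ^m`. -/
def rkOne (u : Rm m) (h : Dualm m) : GLm m := h.smulRight u

variable (σ₁ : GLm m →ₗ[ℝ] (V₁ →L[ℝ] V₁)) (σ₂ : GLm m →ₗ[ℝ] (V₂ →L[ℝ] V₂))

/-- The representation `σ^{(k)}` of `gl(m,ℝ)` on `S^k ℝ^m ⊗ Hom(V₁,V₂)`, determined by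
`σ^{(k)}(B)(h₁∨⋯∨h_k ⊗ A) = Σᵢ h₁∨⋯∨(B hᵢ)∨⋯∨h_k ⊗ A + h₁∨⋯∨h_k ⊗ (σ₂(B)∘A - A∘σ₁(B))`. -/
def sigmaS {k : ℕ} (B : GLm m) (T : Symb m V₁ V₂ k) : Symb m V₁ V₂ k :=
  (∑ t : Fin k, T.compContinuousLinearMap
    (fun s => if s = t then (ContinuousLinearMap.compL ℝ (Rm m) (Rm m) ℝ).flip B
      else ContinuousLinearMap.id ℝ (Dualm m)))
  + ((ContinuousLinearMap.compL ℝ V₁ V₂ V₂ (σ₂ B))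
      - (ContinuousLinearMap.compL ℝ V₁ V₁ V₂).flip (σ₁ B)).compContinuousMultilinearMap T

/-- The `i`-th coordinate covector on `ℝ^m`. -/
def coordD (i : Fin m) : Dualm m := ContinuousLinearMap.proj i

/-- The affine quantization (standard ordering): the full contraction of a degree-`k` symbol
with the `k`-th derivative, `Q_Aff(h₁∨⋯∨h_k ⊗ A)(f) = A(∂_{h₁} ⋯ ∂_{h_k} f)`. -/
def QAff {k : ℕ} (T : Rm m → Symb m V₁ V₂ k) (f : Rm m → V₁) : Rm m → V₂ :=
  fun x => (k.factorial : ℝ)⁻¹ • ∑ d : Fin k → Fin m,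
    (T x (fun t => coordD m (d t))) (iteratedFDeriv ℝ k f x (fun t => Pi.single (d t) 1))

/-- The defining property of the map `γ(h) : S^{k+1} ℝ^m ⊗ Hom(V₁,V₂) → S^k ℝ^m ⊗ Hom(V₁,V₂)`,
for `h ∈ ℝ^{m*} ≅ 𝔤₁`:
`γ(h)(h₁∨⋯∨h_{k+1} ⊗ A) = Σᵢ h₁∨⋯(omit hᵢ)⋯∨h_{k+1} ⊗ (A ∘ σ₁(hᵢ⊗h + h(hᵢ)·Id))`
`- Σᵢ Σ_{j<i} h₁∨⋯(omit hⱼ,hᵢ)⋯∨h_{k+1} ∨ (h(hⱼ)·hᵢ + h(hᵢ)·hⱼ) ⊗ A`. -/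
def gammaProp {k : ℕ}
    (γ : Dualm m → (Symb m V₁ V₂ (k+1) →ₗ[ℝ] Symb m V₁ V₂ k)) : Prop :=
  ∀ (h : Dualm m) (v : Fin (k+1) → Rm m) (A : V₁ →L[ℝ] V₂),
    γ h (symT m V₁ V₂ v A) =
      (∑ i : Fin (k+1), symT m V₁ V₂ (i.removeNth v)
        (A.comp (σ₁ (rkOne m (v i) h + h (v i) • ContinuousLinearMap.id ℝ (Rm m)))))
      - ∑ i : Fin (k+1), ∑ j : Fin k,
          if (i.succAbove j : ℕ) < (i : ℕ) then
            symT m V₁ V₂ (i.removeNth (Function.update v (i.succAbove j)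
              (h (v (i.succAbove j)) • v i + h (v i) • v (i.succAbove j)))) A
          else 0

/-- The model for `⊕_{k=0}^K S^k ℝ^m ⊗ Hom(V₁,V₂)`. -/
abbrev SymbT (K : ℕ) := ∀ k : Fin (K+1), Symb m V₁ V₂ (k : ℕ)

/-- The degree-wise representation `⊕_k σ^{(k)}` on `⊕_{k=0}^K S^k ℝ^m ⊗ Hom(V₁,V₂)`. -/
def sigmaT {K : ℕ} (B : GLm m) (T : SymbT m V₁ V₂ K) : SymbT m V₁ V₂ K :=
  fun k => sigmaS m V₁ V₂ σ₁ σ₂ B (T k)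

/-- The extension of a family `γ` to `⊕_{k=0}^K S^k ℝ^m ⊗ Hom(V₁,V₂)` (lowering degree). -/
def gTot {K : ℕ} (γf : ∀ k : ℕ, Dualm m → (Symb m V₁ V₂ (k+1) →ₗ[ℝ] Symb m V₁ V₂ k))
    (h : Dualm m) (T : SymbT m V₁ V₂ K) : SymbT m V₁ V₂ K :=
  fun k => if hk : (k : ℕ) + 1 < K + 1 then γf (k : ℕ) h (T ⟨(k : ℕ) + 1, hk⟩) else 0


/-- The action `ρ^{(k)}(a) = S^k a ⊗ (Φ ↦ ρ₂(a)∘Φ∘ρ₁(a)⁻¹)` of `GL(m,ℝ)` on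
`S^k ℝ^m ⊗ Hom(V₁,V₂)`, in the model. -/
def rhoK {k : ℕ} (a : (Fin m → ℝ) ≃L[ℝ] (Fin m → ℝ)) (r₁ : V₁ ≃L[ℝ] V₁) (r₂ : V₂ ≃L[ℝ] V₂)
    (T : Symb m V₁ V₂ k) : Symb m V₁ V₂ k :=
  ((ContinuousLinearMap.compL ℝ V₁ V₂ V₂ (r₂ : V₂ →L[ℝ] V₂)) ∘L
    ((ContinuousLinearMap.compL ℝ V₁ V₁ V₂).flip
      ((r₁.symm : V₁ →L[ℝ] V₁)))).compContinuousMultilinearMap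
    (T.compContinuousLinearMap
      (fun _ => (ContinuousLinearMap.compL ℝ (Rm m) (Rm m) ℝ).flip
        (a : (Fin m → ℝ) →L[ℝ] (Fin m → ℝ))))

end Symbols

section Matrices

variable (m : ℕ)

/-- The element of `𝔤₁ ⊂ sl(m+1,ℝ)` with `ξ`-block the covector `h`. -/
def hMat (h : Dualm m) : Matrix (Idx m) (Idx m) ℝ :=
  Matrix.fromBlocks 0 0 (Matrix.of fun _ j => h (Pi.single j 1)) 0

/-- The element of `𝔤₋₁ ⊂ sl(m+1,ℝ)` with `v`-block the vector `X`. -/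
def XMat (X : Rm m) : Matrix (Idx m) (Idx m) ℝ :=
  Matrix.fromBlocks 0 (Matrix.of fun i _ => X i) 0 0

/-- The lift `B̃ ∈ 𝔤₀ ⊂ sl(m+1,ℝ)` of `B ∈ gl(m,ℝ)`, with `ψ(B̃) = B`. -/
def BTilde (B : GLm m) : Matrix (Idx m) (Idx m) ℝ :=
  Matrix.fromBlocks
    (LinearMap.toMatrix' (B : (Fin m → ℝ) →ₗ[ℝ] (Fin m → ℝ))
      - ((LinearMap.trace ℝ (Rm m) (B : (Fin m → ℝ) →ₗ[ℝ] (Fin m → ℝ))) / ((m : ℝ) + 1)) • 1)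
    0 0
    (Matrix.of fun _ _ => -(LinearMap.trace ℝ (Rm m) (B : (Fin m → ℝ) →ₗ[ℝ] (Fin m → ℝ))) / ((m : ℝ) + 1))

/-- The map `ψ : 𝔤₀ → gl(m,ℝ) : [[A,0],[0,a]] ↦ A - a·Id`. -/
def psiC (M : Matrix (Idx m) (Idx m) ℝ) : GLm m :=
  LinearMap.toContinuousLinearMap
    ((Matrix.of fun i j => M (Sum.inl i) (Sum.inl j)).mulVecLin
      - M (Sum.inr ()) (Sum.inr ()) • LinearMap.id)

/-- The basis `(eᵢ)` of `𝔤₋₁`, corresponding to the standard basis of `ℝ^m`. -/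
def eMat (i : Fin m) : Matrix (Idx m) (Idx m) ℝ := XMat m (Pi.single i 1)

/-- The covector `εⁱ = (1/(2(m+1))) δⁱ ∈ ℝ^{m*}`. -/
def epsD (i : Fin m) : Dualm m := (1 / (2 * ((m : ℝ) + 1))) • coordD m i

/-- The basis `(εⁱ)` of `𝔤₁`, Killing-dual to `(eᵢ)`. -/
def epsMat (i : Fin m) : Matrix (Idx m) (Idx m) ℝ := hMat m (epsD m i)

/-- The Euler element `E = diag(-1/(m+1), …, -1/(m+1), m/(m+1)) ∈ 𝔤₀`, with `ψ(E) = -Id`. -/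
def EMat : Matrix (Idx m) (Idx m) ℝ :=
  Matrix.fromBlocks ((-(1 / ((m : ℝ) + 1))) • 1) 0 0 (Matrix.of fun _ _ => (m : ℝ) / ((m : ℝ) + 1))

/-- Membership in `𝔰 ≅ sl(m,ℝ) ⊂ 𝔤₀`: block diagonal with vanishing corner and traceless. -/
def inS (M : Matrix (Idx m) (Idx m) ℝ) : Prop :=
  (∀ i, M (Sum.inl i) (Sum.inr ()) = 0) ∧ (∀ j, M (Sum.inr ()) (Sum.inl j) = 0) ∧
    M (Sum.inr ()) (Sum.inr ()) = 0 ∧ Matrix.trace M = 0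

/-- Membership in `𝔤₋₁`: only the `v`-block is nonzero. -/
def inGm1 (M : Matrix (Idx m) (Idx m) ℝ) : Prop :=
  (∀ i j, M (Sum.inl i) (Sum.inl j) = 0) ∧ (∀ j, M (Sum.inr ()) (Sum.inl j) = 0) ∧
    M (Sum.inr ()) (Sum.inr ()) = 0

/-- Membership in `𝔤₁`: only the `ξ`-block is nonzero. -/
def inG1 (M : Matrix (Idx m) (Idx m) ℝ) : Prop :=
  (∀ i j, M (Sum.inl i) (Sum.inl j) = 0) ∧ (∀ i, M (Sum.inl i) (Sum.inr ()) = 0) ∧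
    M (Sum.inr ()) (Sum.inr ()) = 0

/-- Membership in `𝔤₀`: block diagonal. -/
def inG0 (M : Matrix (Idx m) (Idx m) ℝ) : Prop :=
  (∀ i, M (Sum.inl i) (Sum.inr ()) = 0) ∧ (∀ j, M (Sum.inr ()) (Sum.inl j) = 0)

/-- The Killing form of `sl(m+1,ℝ)`: `κ(M,N) = 2(m+1) tr(MN)`. -/
def kappa (M N : Matrix (Idx m) (Idx m) ℝ) : ℝ := 2 * ((m : ℝ) + 1) * Matrix.trace (M * N)

end Matrices

section SymbolOperators

variable (m : ℕ) (V₁ V₂ : Type)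
  [NormedAddCommGroup V₁] [NormedSpace ℝ V₁] [NormedAddCommGroup V₂] [NormedSpace ℝ V₂]
  (σ₁ : GLm m →ₗ[ℝ] (V₁ →L[ℝ] V₁)) (σ₂ : GLm m →ₗ[ℝ] (V₂ →L[ℝ] V₂))

/-- The operator `C₀ = (1/2)σ^{(k)}(Id) + (1/2m)σ^{(k)}(Id)² + Σ_s σ^{(k)}(ψ(h_s))∘σ^{(k)}(ψ(h_s^*))`
on `S^k ℝ^m ⊗ Hom(V₁,V₂)`. -/
def C0op {k : ℕ} {n : ℕ} (hs hs' : Fin n → Matrix (Idx m) (Idx m) ℝ)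
    (T : Symb m V₁ V₂ k) : Symb m V₁ V₂ k :=
  (1/2 : ℝ) • sigmaS m V₁ V₂ σ₁ σ₂ (ContinuousLinearMap.id ℝ (Rm m)) T
  + (1/(2*(m : ℝ))) • sigmaS m V₁ V₂ σ₁ σ₂ (ContinuousLinearMap.id ℝ (Rm m))
      (sigmaS m V₁ V₂ σ₁ σ₂ (ContinuousLinearMap.id ℝ (Rm m)) T)
  + ∑ s, sigmaS m V₁ V₂ σ₁ σ₂ (psiC m (hs s)) (sigmaS m V₁ V₂ σ₁ σ₂ (psiC m (hs' s)) T)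

/-- `C₀` acting degreewise on `⊕_{k=0}^K S^k ℝ^m ⊗ Hom(V₁,V₂)`. -/
def C0tot {K : ℕ} {n : ℕ} (hs hs' : Fin n → Matrix (Idx m) (Idx m) ℝ)
    (T : SymbT m V₁ V₂ K) : SymbT m V₁ V₂ K :=
  fun k => C0op m V₁ V₂ σ₁ σ₂ hs hs' (T k)

/-- The operator `𝓛_M = L_{X^M} + γ(ξ_M)` (flat curly Lie derivative) on functions with values
in `⊕_{k=0}^K S^k ℝ^m ⊗ Hom(V₁,V₂)`, where `ξ_M` is the `𝔤₁`-component of `M`. -/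
def curlyL {K : ℕ} (γf : ∀ k : ℕ, Dualm m → (Symb m V₁ V₂ (k+1) →ₗ[ℝ] Symb m V₁ V₂ k))
    (M : Matrix (Idx m) (Idx m) ℝ) (f : Rm m → SymbT m V₁ V₂ K) : Rm m → SymbT m V₁ V₂ K :=
  fun x => lieD m (fun B T => sigmaT m V₁ V₂ σ₁ σ₂ B T) (projVF m M) f x
    + gTot m V₁ V₂ γf (∑ j, M (Sum.inr ()) (Sum.inl j) • coordD m j) (f x)

end SymbolOperators

section Curved

variable (m : ℕ) (P : Type) [NormedAddCommGroup P] [NormedSpace ℝ P]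

/-- The invariant derivative `L_{ω^{-1}(Z)} f` along the `ω`-constant vector field `η Z`. -/
def LD (η : Matrix (Idx m) (Idx m) ℝ → P → P) (Z : Matrix (Idx m) (Idx m) ℝ)
    {V : Type} [NormedAddCommGroup V] [NormedSpace ℝ V] (f : P → V) : P → V :=
  fun u => fderiv ℝ f u (η Z u)

/-- The bracket compatibility satisfied by a normal Cartan connection: for `M ∈ 𝔤₀ ⊕ 𝔤₁` and
`N ∈ 𝔤₋₁`, `L_{ω^{-1}(M)} ∘ L_{ω^{-1}(N)} - L_{ω^{-1}(N)} ∘ L_{ω^{-1}(M)} = L_{ω^{-1}([M,N])}` on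
smooth vector-space-valued functions. -/
def BracketCompat (η : Matrix (Idx m) (Idx m) ℝ → P → P) : Prop :=
  ∀ (V : Type) [NormedAddCommGroup V] [NormedSpace ℝ V],
    ∀ f : P → V, ContDiff ℝ (⊤ : ℕ∞) f →
      ∀ M N : Matrix (Idx m) (Idx m) ℝ, Matrix.trace M = 0 → Matrix.trace N = 0 →
        (∀ i, M (Sum.inl i) (Sum.inr ()) = 0) → inGm1 m N →
        (LD m P η M (LD m P η N f) - LD m P η N (LD m P η M f)) = LD m P η (M * N - N * M) f

/-- Infinitesimal `G₀`-equivariance of `f : P → V` with respect to `σ`: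
`L_{ω^{-1}(B̃)} f = -σ(B) f` for all `B ∈ gl(m,ℝ)`. -/
def equivG0 (η : Matrix (Idx m) (Idx m) ℝ → P → P)
    {V : Type} [NormedAddCommGroup V] [NormedSpace ℝ V]
    (σ : GLm m → V → V) (f : P → V) : Prop :=
  ∀ B : GLm m, LD m P η (BTilde m B) f = fun u => -(σ B (f u))

/-- Iterated invariant derivatives along `𝔤₋₁`-constant fields. -/
def iterL (η : Matrix (Idx m) (Idx m) ℝ → P → P)
    {V : Type} [NormedAddCommGroup V] [NormedSpace ℝ V] :
    (k : ℕ) → (Fin k → Rm m) → (P → V) → (P → V)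
  | 0, _, f => f
  | (k+1), v, f => LD m P η (XMat m (v 0)) (iterL η k (fun j => v j.succ) f)

/-- The symmetrized iterated invariant differential `(∇^ω)^k f`, evaluated on
`(X₁, …, X_k) ∈ (ℝ^m)^k`. -/
def nabK (η : Matrix (Idx m) (Idx m) ℝ → P → P)
    {V : Type} [NormedAddCommGroup V] [NormedSpace ℝ V]
    (k : ℕ) (f : P → V) (v : Fin k → Rm m) : P → V :=
  fun u => (k.factorial : ℝ)⁻¹ • ∑ ν : Equiv.Perm (Fin k), iterL m P η k (v ∘ ν) f u

variable (V₁ V₂ : Type)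
  [NormedAddCommGroup V₁] [NormedSpace ℝ V₁] [NormedAddCommGroup V₂] [NormedSpace ℝ V₂]

/-- The curved quantization map: `Q_ω(T)(f)(u) = ⟨T(u), (∇^ω)^k f(u)⟩` (full contraction). -/
def Qom (η : Matrix (Idx m) (Idx m) ℝ → P → P) {k : ℕ}
    (T : P → Symb m V₁ V₂ k) (f : P → V₁) : P → V₂ :=
  fun u => (k.factorial : ℝ)⁻¹ • ∑ d : Fin k → Fin m,
    (T u (fun t => coordD m (d t))) (nabK m P η k f (fun t => Pi.single (d t) 1) u)


/-- The curved operator `N^ω f = -2 Σᵢ γ(εⁱ)(L_{ω^{-1}(eᵢ)} f)`. -/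
def Nom {K : ℕ} (γf : ∀ k : ℕ, Dualm m → (Symb m V₁ V₂ (k+1) →ₗ[ℝ] Symb m V₁ V₂ k))
    (η : Matrix (Idx m) (Idx m) ℝ → P → P) (f : P → SymbT m V₁ V₂ K) : P → SymbT m V₁ V₂ K :=
  fun u => (-2 : ℝ) • ∑ i : Fin m, gTot m V₁ V₂ γf (epsD m i)
    (LD m P η (XMat m (Pi.single i 1)) f u)

end Curved


/-- Polarization: the symmetrization of a multilinear map on copies of `ℝ^m` is determined by its
values on the diagonal. -/
theorem sum_perm_eq_of_diagonal {m n : ℕ} {F : Type*} [NormedAddCommGroup F] [NormedSpace ℝ F]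
    (f g : MultilinearMap ℝ (fun _ : Fin n => Rm m) F)
    (hfg : ∀ w, f (fun _ => w) = g (fun _ => w))
    (v : Fin n → Rm m) : ∑ ν : Equiv.Perm (Fin n), f (v ∘ ν) = ∑ ν : Equiv.Perm (Fin n), g (v ∘ ν) := by
  have hcont (f : MultilinearMap ℝ (fun _ : Fin n => Rm m) F) : Continuous f := by
    have key : ∀ v, f v = ∑ r : Fin n → Fin m,
        (∏ i, v i (r i)) • f (fun i => Pi.single (r i) (1 : ℝ)) := by
      intro v
      conv_lhs => rw [show v = fun i => ∑ j, v i j • (Pi.single j (1 : ℝ) : Rm m) from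
        funext fun i => pi_eq_sum_univ' (v i)]
      rw [f.map_sum]
      exact Finset.sum_congr rfl fun r _ => f.map_smul_univ _ _
    rw [show (f : (Fin n → Rm m) → F) = _ from funext key]
    fun_prop
  let f' : ContinuousMultilinearMap ℝ (fun _ : Fin n => Rm m) F := ⟨f, hcont f⟩
  let g' : ContinuousMultilinearMap ℝ (fun _ : Fin n => Rm m) F := ⟨g, hcont g⟩
  have h : (fun x => f' (fun _ => x)) = fun x => g' (fun _ => x) := funext hfg
  exact (f'.iteratedFDeriv_comp_diagonal 0 v).symm.trans
    (h ▸ g'.iteratedFDeriv_comp_diagonal 0 v)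

section PowerSymbols

variable {m k : ℕ} {V₁ V₂ : Type}
  [NormedAddCommGroup V₁] [NormedSpace ℝ V₁] [NormedAddCommGroup V₂] [NormedSpace ℝ V₂]

theorem pureT_apply (v : Fin k → Rm m) (A : V₁ →L[ℝ] V₂) (x : Fin k → Dualm m) :
    pureT m V₁ V₂ v A x = (∏ i, x i (v i)) • A := by
  simp [pureT]

/-- `pureT` as a multilinear map of its vector arguments. -/
def pureTMultilinear (A : V₁ →L[ℝ] V₂) :
    MultilinearMap ℝ (fun _ : Fin k => Rm m) (Symb m V₁ V₂ k) where
  toFun v := pureT m V₁ V₂ v A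
  map_update_add' {inst} v i a b := by
    obtain rfl := Subsingleton.elim inst (instDecidableEqFin k)
    ext1 x
    simp only [pureT_apply, add_apply, ← add_smul]
    congr 1
    have := ((MultilinearMap.mkPiAlgebra ℝ (Fin k) ℝ).compLinearMap
      (fun i => (x i : Rm m →ₗ[ℝ] ℝ))).map_update_add v i a b
    exact this
  map_update_smul' {inst} v i c a := by
    obtain rfl := Subsingleton.elim inst (instDecidableEqFin k)
    ext1 x
    simp only [pureT_apply, smul_apply, smul_smul]
    congr 1
    have := ((MultilinearMap.mkPiAlgebra ℝ (Fin k) ℝ).compLinearMap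
      (fun i => (x i : Rm m →ₗ[ℝ] ℝ))).map_update_smul v i c a
    exact this

theorem symT_const (w : Rm m) (A : V₁ →L[ℝ] V₂) :
    symT m V₁ V₂ (fun _ : Fin k => w) A
      = (k.factorial : ℝ) • pureT m V₁ V₂ (fun _ : Fin k => w) A := by
  refine Eq.trans ?_ (Nat.cast_smul_eq_nsmul ℝ k.factorial
    (pureT m V₁ V₂ (fun _ => w) A)).symm
  simp [symT, Function.comp_def, Fintype.card_perm]

theorem symT_update_const (w : Rm m) (j : Fin k) (c : ℝ) (A : V₁ →L[ℝ] V₂) :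
    symT m V₁ V₂ (Function.update (fun _ => w) j (c • w)) A
      = c • symT m V₁ V₂ (fun _ => w) A := by
  have key (ν : Equiv.Perm (Fin k)) :
      pureT m V₁ V₂ (Function.update (fun _ => w) j (c • w) ∘ ν) A
        = c • pureT m V₁ V₂ (fun _ => w) A := by
    have := (pureTMultilinear (k := k) A).map_update_smul (fun _ => w) (ν.symm j) c w
    rw [Function.update_eq_self (f := fun _ : Fin k => w)] at this
    rw [Function.update_comp_equiv]
    exact this
  simp only [symT, key, Finset.smul_sum]
  rfl

theorem symT_add_smul (v : Fin k → Rm m) (a b : ℝ) (A B : V₁ →L[ℝ] V₂) :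
    symT m V₁ V₂ v (a • A + b • B) = a • symT m V₁ V₂ v A + b • symT m V₁ V₂ v B := by
  simp only [symT, Finset.smul_sum, ← Finset.sum_add_distrib]
  refine Finset.sum_congr rfl fun ν _ => ?_
  ext1 x
  simp only [pureT_apply, add_apply, smul_apply]
  module

theorem sum_ite_succAbove_lt (k : ℕ) :
    ∑ i : Fin (k+1), ∑ j : Fin k, (if (i.succAbove j : ℕ) < (i : ℕ) then (2 : ℝ) else 0)
      = (k + 1) * k := by
  have h1 (i : Fin (k+1)) :
      ∑ j : Fin k, (if (i.succAbove j : ℕ) < (i : ℕ) then (2 : ℝ) else 0) = 2 * (i : ℕ) := by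
    have h2 (j : Fin k) : ((i.succAbove j : ℕ) < (i : ℕ)) ↔ (j : ℕ) < (i : ℕ) := by
      rw [← Fin.lt_def, Fin.succAbove_lt_iff_castSucc_lt]; rfl
    simp only [h2]
    rw [← Finset.sum_filter, Finset.sum_const, Fin.card_filter_val_lt,
      min_eq_right (Nat.lt_succ_iff.mp i.2), nsmul_eq_mul, mul_comm]
  simp only [h1]
  rw [← Finset.mul_sum, Fin.sum_univ_eq_sum_range (fun i : ℕ => (i : ℝ)), mul_comm]
  have := Finset.sum_range_id_mul_two (k+1)
  simpa using congrArg (Nat.cast : ℕ → ℝ) this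

theorem sum_ite_succAbove_lt_smul (k : ℕ) {F : Type*} [AddCommGroup F] [Module ℝ F]
    (c : ℝ) (x : F) :
    ∑ i : Fin (k+1), ∑ j : Fin k,
      (if (i.succAbove j : ℕ) < (i : ℕ) then (2 * c) • x else 0) = ((k + 1) * k * c) • x := by
  rw [← sum_ite_succAbove_lt]
  simp only [Finset.sum_mul, Finset.sum_smul, ite_mul, zero_mul, ite_smul, zero_smul]

/-- The value of `γ(h)` on a symmetric power `w ∨ ⋯ ∨ w ⊗ A`. -/
theorem gammaProp.apply_const {σ₁ : GLm m →ₗ[ℝ] (V₁ →L[ℝ] V₁)}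
    {γ : Dualm m → (Symb m V₁ V₂ (k+1) →ₗ[ℝ] Symb m V₁ V₂ k)}
    (hγ : gammaProp m V₁ V₂ σ₁ γ) (h : Dualm m) (w : Rm m) (A : V₁ →L[ℝ] V₂) :
    γ h (symT m V₁ V₂ (fun _ => w) A) = ((k : ℝ) + 1) • symT m V₁ V₂ (fun _ => w)
      (A.comp (σ₁ (rkOne m w h + h w • ContinuousLinearMap.id ℝ (Rm m))
        - ((k : ℝ) * h w) • ContinuousLinearMap.id ℝ V₁)) := by
  have hrem (i : Fin (k+1)) (j : Fin k) :
      symT m V₁ V₂ (i.removeNth (Function.update (fun _ => w) (i.succAbove j)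
        (h w • w + h w • w))) A = (2 * h w) • symT m V₁ V₂ (fun _ => w) A := by
    rw [← symT_update_const w j, ← add_smul, ← two_mul]
    congr 1
    ext l : 1
    by_cases hl : l = j
    · subst hl; simp [Fin.removeNth]
    · simp [Fin.removeNth, hl]
  have hcomp (B : V₁ →L[ℝ] V₁) (c : ℝ) : A.comp (B - c • ContinuousLinearMap.id ℝ V₁)
      = (1 : ℝ) • A.comp B + (-c) • A := by
    ext x; simp [sub_eq_add_neg]
  rw [hγ]
  simp only [hrem]
  rw [sum_ite_succAbove_lt_smul k (h w) (symT m V₁ V₂ (fun _ => w) A), hcomp, symT_add_smul]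
  have hr (i : Fin (k+1)) : i.removeNth (fun _ => w) = fun _ : Fin k => w := rfl
  simp only [hr, Finset.sum_const, Finset.card_univ, Fintype.card_fin,
    ← Nat.cast_smul_eq_nsmul ℝ]
  push_cast
  module

theorem rkOne_bracket (w : Rm m) (h h' : Dualm m) :
    (rkOne m w h + h w • ContinuousLinearMap.id ℝ (Rm m)) ∘L
        (rkOne m w h' + h' w • ContinuousLinearMap.id ℝ (Rm m))
      - (rkOne m w h' + h' w • ContinuousLinearMap.id ℝ (Rm m)) ∘L
        (rkOne m w h + h w • ContinuousLinearMap.id ℝ (Rm m))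
      = h w • (rkOne m w h' + h' w • ContinuousLinearMap.id ℝ (Rm m))
        - h' w • (rkOne m w h + h w • ContinuousLinearMap.id ℝ (Rm m)) := by
  ext x i
  simp [rkOne]
  ring

/-- The product of `σ₁(w ⊗ h' + h'(w)·Id) - (c+1) h'(w)` and `σ₁(w ⊗ h + h(w)·Id) - c h(w)` is
symmetric in `h` and `h'`. -/
theorem IsLieRep.shifted_comp_comm {σ₁ : GLm m →ₗ[ℝ] (V₁ →L[ℝ] V₁)} (hσ₁ : IsLieRep m σ₁)
    (w : Rm m) (h h' : Dualm m) (c : ℝ) :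
    (σ₁ (rkOne m w h' + h' w • ContinuousLinearMap.id ℝ (Rm m))
        - ((c + 1) * h' w) • ContinuousLinearMap.id ℝ V₁).comp
      (σ₁ (rkOne m w h + h w • ContinuousLinearMap.id ℝ (Rm m))
        - (c * h w) • ContinuousLinearMap.id ℝ V₁)
    = (σ₁ (rkOne m w h + h w • ContinuousLinearMap.id ℝ (Rm m))
        - ((c + 1) * h w) • ContinuousLinearMap.id ℝ V₁).comp
      (σ₁ (rkOne m w h' + h' w • ContinuousLinearMap.id ℝ (Rm m))
        - (c * h' w) • ContinuousLinearMap.id ℝ V₁) := by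
  have hb := hσ₁ (rkOne m w h + h w • ContinuousLinearMap.id ℝ (Rm m))
    (rkOne m w h' + h' w • ContinuousLinearMap.id ℝ (Rm m))
  rw [rkOne_bracket, map_sub, map_smul, map_smul] at hb
  generalize σ₁ (rkOne m w h + h w • ContinuousLinearMap.id ℝ (Rm m)) = B at hb ⊢
  generalize σ₁ (rkOne m w h' + h' w • ContinuousLinearMap.id ℝ (Rm m)) = B' at hb ⊢
  ext x
  have hx := DFunLike.congr_fun hb x
  simp only [sub_apply, smul_apply,
    ContinuousLinearMap.comp_apply, ContinuousLinearMap.id_apply, map_sub, map_smul] at hx ⊢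
  linear_combination (norm := module) hx

end PowerSymbols

/-- the operators `γ(h)` and `γ(h')` commute:
`γ(h)∘γ(h') = γ(h')∘γ(h) : S^k ℝ^m ⊗ Hom(V₁,V₂) → S^{k-2} ℝ^m ⊗ Hom(V₁,V₂)`. -/
theorem statement5 (m k : ℕ) (hm : 2 ≤ m)
    (V₁ V₂ : Type) [NormedAddCommGroup V₁] [NormedSpace ℝ V₁] [FiniteDimensional ℝ V₁]
    [NormedAddCommGroup V₂] [NormedSpace ℝ V₂] [FiniteDimensional ℝ V₂]
    (σ₁ : GLm m →ₗ[ℝ] (V₁ →L[ℝ] V₁)) (hσ₁ : IsLieRep m σ₁)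
    (γ₁ : Dualm m → (Symb m V₁ V₂ (k+2) →ₗ[ℝ] Symb m V₁ V₂ (k+1)))
    (γ₂ : Dualm m → (Symb m V₁ V₂ (k+1) →ₗ[ℝ] Symb m V₁ V₂ k))
    (hγ₁ : gammaProp m V₁ V₂ σ₁ γ₁) (hγ₂ : gammaProp m V₁ V₂ σ₁ γ₂)
    (h h' : Dualm m) :
    ∀ u ∈ spanGen m V₁ V₂ (k+2), γ₂ h (γ₁ h' u) = γ₂ h' (γ₁ h u) := by
  let D : Symb m V₁ V₂ (k+2) →ₗ[ℝ] Symb m V₁ V₂ k := γ₂ h ∘ₗ γ₁ h'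
  let D' : Symb m V₁ V₂ (k+2) →ₗ[ℝ] Symb m V₁ V₂ k := γ₂ h' ∘ₗ γ₁ h
  have hpow (w : Rm m) (A : V₁ →L[ℝ] V₂) :
      D (symT m V₁ V₂ (fun _ => w) A) = D' (symT m V₁ V₂ (fun _ => w) A) := by
    change γ₂ h (γ₁ h' _) = γ₂ h' (γ₁ h _)
    rw [hγ₁.apply_const, hγ₁.apply_const, map_smul, map_smul, hγ₂.apply_const, hγ₂.apply_const,
      ContinuousLinearMap.comp_assoc, ContinuousLinearMap.comp_assoc, Nat.cast_add, Nat.cast_one,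
      hσ₁.shifted_comp_comm]
  have hdiag (A : V₁ →L[ℝ] V₂) (w : Rm m) :
      D.compMultilinearMap (pureTMultilinear A) (fun _ => w)
        = D'.compMultilinearMap (pureTMultilinear A) (fun _ => w) := by
    have hw := hpow w A
    rw [symT_const, map_smul, map_smul] at hw
    exact smul_right_injective _ (Nat.cast_ne_zero.mpr (Nat.factorial_ne_zero (k+2))) hw
  have hD : spanGen m V₁ V₂ (k+2) ≤ LinearMap.eqLocus D D' := by
    refine Submodule.span_le.mpr ?_
    rintro _ ⟨v, A, rfl⟩
    have hv := sum_perm_eq_of_diagonal (F := Symb m V₁ V₂ k)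
      (D.compMultilinearMap (pureTMultilinear A)) (D'.compMultilinearMap (pureTMultilinear A))
      (hdiag A) v
    change D _ = D' _
    rw [symT, map_sum, map_sum]
    exact hv
  exact fun u hu => hD hu

end ProjQuant
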